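/- arXiv:1401.2022 — 3 statements merged into one kernel-verified Lean document; each statement's English description precedes it below -/
import Mathlib

section
/- There exists a 3-(23,4,1) packing design with 419 blocks; consequently A(23,4,4) = J(23,4,4) = 419. -/
/-- A 3-(n,4,1) packing design (packing quadruple system PQS(n)) on the point
set `Fin n`: a collection of 4-element blocks such that every 3-element subset
of points is contained in at most one block. -/
def IsPQS (n : ℕ) (B : Finset (Finset (Fin n))) : Prop :=
  (∀ b ∈ B, b.card = 4) ∧
  ∀ t : Finset (Fin n), t.card = 3 → (B.filter (fun b => t ⊆ b)).card ≤ 1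

/-- The packing number A(n,4,4): the maximum number of blocks in a
3-(n,4,1) packing design. -/
noncomputable def packingNumber (n : ℕ) : ℕ :=
  sSup {N | ∃ B : Finset (Finset (Fin n)), IsPQS n B ∧ B.card = N}

/-- The Johnson bound J(n,4,4). -/
def johnsonBound (n : ℕ) : ℕ :=
  if n % 6 = 0 then n * ((n - 1) * ((n - 2) / 2) / 3) / 4 - 1
  else n * ((n - 1) * ((n - 2) / 2) / 3) / 4

open Finset

namespace IsPQS

variable {n : ℕ} {B : Finset (Finset (Fin n))}

theorem eq_of_subset (h : IsPQS n B) {t b c : Finset (Fin n)} (ht : t.card = 3)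
    (hb : b ∈ B) (hc : c ∈ B) (htb : t ⊆ b) (htc : t ⊆ c) : b = c :=
  card_le_one.mp (h.2 t ht) b (by simp [hb, htb]) c (by simp [hc, htc])

theorem card_filter_pair_le (h : IsPQS n B) {x y : Fin n} (hxy : x ≠ y) :
    (B.filter fun b => x ∈ b ∧ y ∈ b).card ≤ (n - 2) / 2 := by
  have key := card_mul_le_card_mul (s := B.filter fun b => x ∈ b ∧ y ∈ b)
    (t := univ \ {x, y}) (fun b z => z ∈ b) (m := 2) (n := 1) ?_ ?_
  · rw [card_sdiff_of_subset (subset_univ _), card_pair hxy, card_univ, Fintype.card_fin] at key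
    omega
  · intro b hb
    simp only [mem_filter] at hb
    have hsub : b \ {x, y} ⊆ (univ \ {x, y}).bipartiteAbove (fun b z => z ∈ b) b := by
      intro z hz
      simp_all [bipartiteAbove]
    refine le_trans ?_ (card_le_card hsub)
    rw [card_sdiff_of_subset (by simp [insert_subset_iff, hb]), card_pair hxy, h.1 b hb.1]
  · intro z hz
    refine card_le_one.mpr fun b hb c hc => ?_
    simp only [bipartiteBelow, mem_filter] at hb hc
    simp only [mem_sdiff, mem_univ, mem_insert, mem_singleton, true_and, not_or] at hz
    exact h.eq_of_subset (t := {x, y, z})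
      (card_eq_three.mpr ⟨x, y, z, hxy, Ne.symm hz.1, Ne.symm hz.2, rfl⟩) hb.1.1 hc.1.1
      (by simp [insert_subset_iff, hb]) (by simp [insert_subset_iff, hc])

theorem card_filter_mem_le (h : IsPQS n B) (x : Fin n) :
    (B.filter fun b => x ∈ b).card ≤ (n - 1) * ((n - 2) / 2) / 3 := by
  have key := card_mul_le_card_mul (s := B.filter fun b => x ∈ b)
    (t := univ.erase x) (fun b y => y ∈ b) (m := 3) (n := (n - 2) / 2) ?_ ?_
  · rw [card_erase_of_mem (mem_univ x), card_univ, Fintype.card_fin] at key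
    omega
  · intro b hb
    simp only [mem_filter] at hb
    have hsub : b.erase x ⊆ (univ.erase x).bipartiteAbove (fun b y => y ∈ b) b := by
      intro z hz
      simp_all [bipartiteAbove]
    refine le_trans ?_ (card_le_card hsub)
    rw [card_erase_of_mem hb.2, h.1 b hb.1]
  · intro y hy
    rw [bipartiteBelow, filter_filter]
    exact h.card_filter_pair_le (ne_of_mem_erase hy).symm

theorem card_le (h : IsPQS n B) : B.card ≤ n * ((n - 1) * ((n - 2) / 2) / 3) / 4 := by
  have key := card_mul_le_card_mul (s := B) (t := univ) (fun b x => x ∈ b) (m := 4)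
    (n := (n - 1) * ((n - 2) / 2) / 3) ?_ fun x _ => h.card_filter_mem_le x
  · rw [card_univ, Fintype.card_fin] at key
    omega
  · intro b hb
    simp [bipartiteAbove, h.1 b hb]

end IsPQS

/-- The rows of the incidence matrix of a packing design with 23 points and 419 blocks: bit `k` of
the entry at position `x` is set when `x` lies on the `k`-th block. The design is invariant under a
group isomorphic to `A₄` with point orbits of sizes 6, 6, 4, 4 and 3. -/
def incidenceRows : List ℕ :=
   [9444732965739290427391,
    87112285931760246637179166536793371706367,
    1569275433846670103846661424041674783660234851360755416065,
    55213970774322941024044200272539622783382558368228254790535301364712450,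
    15177100720458294395784371801994894317808758150763670979374782075453674586348980228,
    32592575606174676666793796936356278081270978465136613420874986357016451156933907578997968896,
    2187250692190437259178070684474191740522748371224854163377120229740184900655310760210081895356047364,
    9173992276710050152095806030311073262760064028698732305775890753604083226039491201593891071094798021560328,
    1202444628418547429431030776570851694132238194875938139936168232445895538991390720783757316341009101192958582800,
    78802810003204646645069761869973318485074968687752695538666322527309700393932645653992777661497769524433349125342240,
    161311816975923327059630353664155743524446383975307501630150144732345482812469513296496319440547978908891595536011886593,
    82470842042543927756491954551604944444090401833518313887742865586128416247154046148664006697286800041103571233540606529600,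
    1241905529449725306528342630363161364667826871596765393740243484831979739459404723616671774064161367378286355723818222239776,
    4232484073030062259200453543982599182181132114142536682200512605774033329145069518923317621346036311994791144699516946513984,
    7044766346212654764702643074848217288626880560723110686473432064757151618661388034362616802712594289070144210862055171833984,
    8720339305031070023382085133658114536878750376911762110381995943731375893094403414940490158756525930379621104052932299489536,
    158679355898685024709097372335952541248466743116576573043317354278981173714914105111012023699976039015124295947596626808340496,
    539463719098878970072353399726473235691586367178631189801907727836713947222530069232634150573084569734676641161864020069843456,
    899088098139514294901536292727369676802139331858222683232977608558885233834635111155776138179230976202546348999413217036926984,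
    1110598610017579912700312423655216364742596192611378981074725321525010737111318670689934989495175777258066304259124128936755202,
    1083801463990821876898639227105960729186511138364416774657645873340660293410327832516203410122878408434012486928010300591702144,
    960360701504743834010157957664696848350634238356128683580981308222786653944854104478554489224222775338084191583683412643283456,
    642056420193105564660089394564573632943956370689516948523897501066841045435669389300031650387349372285503551623949650292375808]

/-- The `k`-th block of the design with incidence matrix `incidenceRows`. -/
def incidenceBlock (k : ℕ) : Finset (Fin 23) :=
  univ.filter fun x => (incidenceRows.getD x 0).testBit k

theorem mem_incidenceBlock {k : ℕ} {x : Fin 23} :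
    x ∈ incidenceBlock k ↔ (incidenceRows.getD x 0).testBit k = true := by
  simp [incidenceBlock]

theorem card_incidenceBlock : ∀ k < 419, (incidenceBlock k).card = 4 := by
  decide +kernel

theorem incidenceRows_land : ∀ x y z : Fin 23, x < y → y < z →
    let m := incidenceRows.getD x 0 &&& incidenceRows.getD y 0 &&& incidenceRows.getD z 0
    m = 0 ∨ m = 2 ^ m.log2 := by
  decide +kernel

theorem incidenceBlock_index_unique {t : Finset (Fin 23)} (ht : t.card = 3) {k l : ℕ}
    (hk : t ⊆ incidenceBlock k) (hl : t ⊆ incidenceBlock l) : k = l := by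
  let f := t.orderEmbOfFin ht
  have hf (i : Fin 3) : f i ∈ t := t.orderEmbOfFin_mem ht i
  have hbit {j : ℕ} (hj : t ⊆ incidenceBlock j) :
      (incidenceRows.getD (f 0) 0 &&& incidenceRows.getD (f 1) 0 &&&
        incidenceRows.getD (f 2) 0).testBit j = true := by
    simp only [Nat.testBit_land, Bool.and_eq_true]
    exact ⟨⟨mem_incidenceBlock.mp (hj (hf 0)), mem_incidenceBlock.mp (hj (hf 1))⟩,
      mem_incidenceBlock.mp (hj (hf 2))⟩
  have hk' := hbit hk
  have hl' := hbit hl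
  rcases incidenceRows_land (f 0) (f 1) (f 2) (f.strictMono (by decide))
    (f.strictMono (by decide)) with h0 | h2
  · rw [h0, Nat.zero_testBit] at hk'
    exact absurd hk' (by decide)
  · rw [h2, Nat.testBit_two_pow, decide_eq_true_eq] at hk' hl'
    exact hk'.symm.trans hl'

theorem incidenceBlock_injOn : Set.InjOn incidenceBlock (range 419) := by
  intro k hk l _ hkl
  obtain ⟨t, htk, ht⟩ := exists_subset_card_eq (s := incidenceBlock k) (n := 3)
    (by rw [card_incidenceBlock k (by simpa using hk)]; decide)
  exact incidenceBlock_index_unique ht htk (hkl ▸ htk)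

theorem isPQS_image_incidenceBlock : IsPQS 23 ((range 419).image incidenceBlock) := by
  refine ⟨fun b hb => ?_, fun t ht => card_le_one.mpr fun b hb c hc => ?_⟩
  · obtain ⟨k, hk, rfl⟩ := mem_image.mp hb
    exact card_incidenceBlock k (mem_range.mp hk)
  · obtain ⟨hb, htb⟩ := mem_filter.mp hb
    obtain ⟨hc, htc⟩ := mem_filter.mp hc
    obtain ⟨k, -, rfl⟩ := mem_image.mp hb
    obtain ⟨l, -, rfl⟩ := mem_image.mp hc
    rw [incidenceBlock_index_unique ht htb htc]

/-- There exists a 3-(23,4,1) packing design with 419 blocks; consequently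
A(23,4,4) = J(23,4,4) = 419. -/
theorem exists_MPQS_23 :
    (∃ B : Finset (Finset (Fin 23)), IsPQS 23 B ∧ B.card = 419) ∧
    packingNumber 23 = johnsonBound 23 ∧ johnsonBound 23 = 419 := by
  have hJ : johnsonBound 23 = 419 := by decide
  have hB : ∃ B : Finset (Finset (Fin 23)), IsPQS 23 B ∧ B.card = 419 :=
    ⟨(range 419).image incidenceBlock, isPQS_image_incidenceBlock, by
      rw [card_image_of_injOn incidenceBlock_injOn, card_range]⟩
  refine ⟨hB, ?_, hJ⟩
  rw [hJ]
  refine IsGreatest.csSup_eq ⟨hB, ?_⟩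
  rintro _ ⟨B, h, rfl⟩
  exact h.card_le
end

section
/- There exists a 3-(35,4,1) packing design with 1583 blocks; consequently A(35,4,4) = J(35,4,4) = 1583. -/
section JohnsonBound

variable {n : ℕ} {B : Finset (Finset (Fin n))}

lemma IsPQS.eq_of_subset_s3 (hB : IsPQS n B) {b c t : Finset (Fin n)} (hb : b ∈ B)
    (hc : c ∈ B) (ht : t.card = 3) (htb : t ⊆ b) (htc : t ⊆ c) : b = c :=
  Finset.card_le_one.mp (hB.2 t ht) b (Finset.mem_filter.mpr ⟨hb, htb⟩) c
    (Finset.mem_filter.mpr ⟨hc, htc⟩)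

/-- The blocks through two points, with these points removed, are disjoint pairs. -/
lemma IsPQS.card_filter_pair_le_s3 (hB : IsPQS n B) {x y : Fin n} (hxy : x ≠ y) :
    (B.filter fun b => x ∈ b ∧ y ∈ b).card ≤ (n - 2) / 2 := by
  have hdisj : ((B.filter fun b => x ∈ b ∧ y ∈ b : Finset _) :
      Set (Finset (Fin n))).PairwiseDisjoint fun b => b \ {x, y} := by
    intro b hb c hc hbc
    simp only [Finset.coe_filter, Set.mem_ofPred_eq] at hb hc
    refine Finset.disjoint_left.mpr fun z hzb hzc => hbc ?_
    simp only [Finset.mem_sdiff, Finset.mem_insert, Finset.mem_singleton, not_or] at hzb hzc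
    refine hB.eq_of_subset_s3 (t := {x, y, z}) hb.1 hc.1 ?_ ?_ ?_
    · exact Finset.card_eq_three.mpr ⟨x, y, z, hxy, Ne.symm hzb.2.1, Ne.symm hzb.2.2, rfl⟩
    · simp [Finset.insert_subset_iff, hb.2, hzb.1]
    · simp [Finset.insert_subset_iff, hc.2, hzc.1]
  have hcard : ∀ b ∈ B.filter (fun b => x ∈ b ∧ y ∈ b), (b \ {x, y}).card = 2 := by
    intro b hb
    rw [Finset.mem_filter] at hb
    rw [Finset.card_sdiff_of_subset (by simp [Finset.insert_subset_iff, hb.2]), hB.1 b hb.1,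
      Finset.card_pair hxy]
  have hle : ((B.filter fun b => x ∈ b ∧ y ∈ b).biUnion fun b => b \ {x, y}).card
      ≤ (Finset.univ \ {x, y} : Finset (Fin n)).card :=
    Finset.card_le_card <| Finset.biUnion_subset.mpr fun b _ =>
      Finset.sdiff_subset_sdiff (Finset.subset_univ b) subset_rfl
  rw [Finset.card_biUnion hdisj, Finset.sum_congr rfl hcard, Finset.sum_const, smul_eq_mul,
    Finset.card_sdiff_of_subset (Finset.subset_univ _), Finset.card_pair hxy, Finset.card_univ,
    Fintype.card_fin] at hle
  omega

lemma IsPQS.card_filter_mem_le_s3 (hB : IsPQS n B) (x : Fin n) :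
    (B.filter fun b => x ∈ b).card ≤ (n - 1) * ((n - 2) / 2) / 3 := by
  have hcount : ∑ b ∈ B.filter (fun b => x ∈ b), ((Finset.univ.erase x).filter (· ∈ b)).card
      = ∑ y ∈ Finset.univ.erase x, ((B.filter fun b => x ∈ b).filter (y ∈ ·)).card :=
    Finset.sum_card_bipartiteAbove_eq_sum_card_bipartiteBelow fun b y => y ∈ b
  have hcard : ∀ b ∈ B.filter (fun b => x ∈ b),
      ((Finset.univ.erase x).filter (· ∈ b)).card = 3 := by
    intro b hb
    rw [Finset.mem_filter] at hb
    have : (Finset.univ.erase x).filter (· ∈ b) = b.erase x := by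
      ext y
      simp
    rw [this, Finset.card_erase_of_mem hb.2, hB.1 b hb.1]
  have hle : ∑ y ∈ Finset.univ.erase x, ((B.filter fun b => x ∈ b).filter (y ∈ ·)).card
      ≤ (Finset.univ.erase x).card • ((n - 2) / 2) := by
    refine Finset.sum_le_card_nsmul _ _ _ fun y hy => ?_
    rw [Finset.filter_filter]
    exact hB.card_filter_pair_le_s3 (Finset.ne_of_mem_erase hy).symm
  rw [← hcount, Finset.sum_congr rfl hcard, Finset.sum_const, smul_eq_mul, smul_eq_mul,
    Finset.card_erase_of_mem (Finset.mem_univ x), Finset.card_univ, Fintype.card_fin] at hle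
  omega

lemma IsPQS.card_le_s3 (hB : IsPQS n B) :
    B.card ≤ n * ((n - 1) * ((n - 2) / 2) / 3) / 4 := by
  have hcount : ∑ b ∈ B, (Finset.univ.filter (· ∈ b)).card
      = ∑ x : Fin n, (B.filter (x ∈ ·)).card :=
    Finset.sum_card_bipartiteAbove_eq_sum_card_bipartiteBelow fun b x => x ∈ b
  have hcard : ∀ b ∈ B, (Finset.univ.filter (· ∈ b)).card = 4 := by
    intro b hb
    rw [Finset.filter_univ_mem, hB.1 b hb]
  have hle := Finset.sum_le_card_nsmul Finset.univ (fun x : Fin n => (B.filter (x ∈ ·)).card) _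
    fun x _ => hB.card_filter_mem_le_s3 x
  rw [← hcount, Finset.sum_congr rfl hcard, Finset.sum_const, smul_eq_mul, smul_eq_mul,
    Finset.card_univ, Fintype.card_fin] at hle
  omega

end JohnsonBound

namespace PackingDesign35

section FreshList

/-- `allFresh l m` says that the entries of `l` are distinct and avoid the bits set in `m`. -/
def allFresh : List ℕ → ℕ → Bool
  | [], _ => true
  | c :: l, m => !m.testBit c && allFresh l (m ||| 1 <<< c)

lemma nodup_of_allFresh {l : List ℕ} {m : ℕ} (h : allFresh l m = true) :
    l.Nodup ∧ ∀ c ∈ l, m.testBit c = false := by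
  induction l generalizing m with
  | nil => simp
  | cons c l ih =>
    simp only [allFresh, Bool.and_eq_true, Bool.not_eq_true'] at h
    obtain ⟨hnd, hl⟩ := ih h.2
    simp only [Nat.testBit_or, Nat.one_shiftLeft, Nat.testBit_two_pow, Bool.or_eq_false_iff,
      decide_eq_false_iff_not] at hl
    refine ⟨List.nodup_cons.mpr ⟨fun hc => (hl c hc).2 rfl, hnd⟩, ?_⟩
    rintro d (_ | ⟨_, hd⟩)
    exacts [h.1, (hl d hd).1]

end FreshList

/-- A block, listed in some order. -/
abbrev Quad := Fin 35 × Fin 35 × Fin 35 × Fin 35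

/-- The `k`-th power of the permutation
`(0 1 … 23) (24 25 … 29) (30 31 32) (33 34)`. -/
def rotate (k x : ℕ) : Fin 35 :=
  Fin.ofNat 35 <|
    if x < 24 then (x + k) % 24
    else if x < 30 then 24 + (x - 24 + k) % 6
    else if x < 33 then 30 + (x - 30 + k) % 3
    else 33 + (x - 33 + k) % 2

/-- Representatives of the block orbits under `rotate 1`, grouped by orbit length. -/
def baseBlocks : List (ℕ × List (ℕ × ℕ × ℕ × ℕ)) :=
  [
    (2, [(24, 26, 28, 34)]),
    (3, [(24, 25, 27, 28), (24, 27, 31, 32), (24, 27, 33, 34)]),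
    (6, [(24, 25, 26, 32), (24, 25, 30, 33), (24, 26, 31, 33), (24, 30, 31, 34)]),
    (12, [(0, 12, 24, 27), (0, 12, 25, 29), (0, 12, 26, 28), (0, 12, 30, 31), (0, 12, 33, 34)]),
    (24, [(0, 1, 2, 33), (0, 1, 3, 13), (0, 1, 4, 8), (0, 1, 5, 12), (0, 1, 6, 25),
      (0, 1, 7, 31), (0, 1, 9, 20), (0, 1, 10, 29), (0, 1, 11, 19), (0, 1, 14, 21),
      (0, 1, 15, 30), (0, 1, 16, 32), (0, 1, 17, 22), (0, 1, 18, 24), (0, 1, 26, 27),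
      (0, 2, 4, 16), (0, 2, 5, 28), (0, 2, 7, 17), (0, 2, 8, 15), (0, 2, 9, 34),
      (0, 2, 10, 13), (0, 2, 11, 18), (0, 2, 20, 29), (0, 2, 21, 32), (0, 2, 24, 25),
      (0, 2, 26, 30), (0, 2, 27, 31), (0, 3, 6, 33), (0, 3, 8, 20), (0, 3, 9, 15),
      (0, 3, 10, 25), (0, 3, 11, 24), (0, 3, 18, 29), (0, 3, 27, 30), (0, 3, 28, 31),
      (0, 4, 9, 25), (0, 4, 10, 26), (0, 4, 14, 19), (0, 4, 15, 24), (0, 4, 18, 32),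
      (0, 4, 28, 30), (0, 4, 29, 34), (0, 4, 31, 33), (0, 5, 11, 30), (0, 5, 18, 34),
      (0, 5, 25, 33), (0, 5, 26, 31), (0, 6, 14, 26), (0, 7, 25, 27), (0, 7, 29, 30),
      (0, 7, 32, 33), (0, 8, 24, 29), (0, 8, 25, 30), (0, 8, 28, 33), (0, 8, 32, 34),
      (0, 9, 24, 33), (0, 9, 26, 32), (0, 10, 27, 33), (0, 10, 28, 34), (0, 11, 25, 28),
      (0, 11, 27, 29), (0, 11, 31, 32)])
  ]

/-- The blocks of the design. -/
def quads : List Quad :=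
  baseBlocks.flatMap fun p => p.2.flatMap fun (a, b, c, d) =>
    (List.range p.1).map fun k => (rotate k a, rotate k b, rotate k c, rotate k d)

/-- The set of points of a listed block. -/
def support (q : Quad) : Finset (Fin 35) := {q.1, q.2.1, q.2.2.1, q.2.2.2}

/-- The first three power sums modulo 37; by the Newton identities they determine a
triple. -/
def code (a b c : Fin 35) : ℕ :=
  (a.val + b.val + c.val) % 37
    + 37 * ((a.val ^ 2 + b.val ^ 2 + c.val ^ 2) % 37)
    + 37 ^ 2 * ((a.val ^ 3 + b.val ^ 3 + c.val ^ 3) % 37)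

/-- The codes of the four triples in a listed block. -/
def tripleCodes : Quad → List ℕ
  | (a, b, c, d) => [code a b c, code a b d, code a c d, code b c d]

/-- The code of a set of points, agreeing with `code` on triples. -/
def setCode (t : Finset (Fin 35)) : ℕ :=
  (∑ x ∈ t, x.val) % 37 + 37 * ((∑ x ∈ t, x.val ^ 2) % 37) + 37 ^ 2 * ((∑ x ∈ t, x.val ^ 3) % 37)

lemma setCode_triple {a b c : Fin 35} (h : ({a, b, c} : Finset (Fin 35)).card = 3) :
    setCode {a, b, c} = code a b c := by
  obtain ⟨hab, hac, hbc⟩ : a ≠ b ∧ a ≠ c ∧ b ≠ c := by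
    refine ⟨?_, ?_, ?_⟩ <;> rintro rfl <;>
      exact absurd h (by simpa using (Finset.card_le_two.trans_lt (by norm_num)).ne)
  have ha : a ∉ ({b, c} : Finset (Fin 35)) := by simp [hab, hac]
  simp [setCode, code, Finset.sum_insert ha, Finset.sum_pair hbc, add_assoc]

lemma setCode_mem_tripleCodes {q : Quad} {t : Finset (Fin 35)} (hq : (support q).card = 4)
    (ht : t.card = 3) (htq : t ⊆ support q) : setCode t ∈ tripleCodes q := by
  obtain ⟨a, b, c, d⟩ := q
  obtain ⟨x, hx, hxt⟩ := Finset.exists_mem_notMem_of_card_lt_card (hq ▸ ht ▸ by norm_num :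
    t.card < (support (a, b, c, d)).card)
  have key : ∀ u v w : Fin 35, t ⊆ {u, v, w} → setCode t = code u v w := by
    intro u v w huvw
    have htu := Finset.eq_of_subset_of_card_le huvw (Finset.card_le_three.trans ht.ge)
    subst htu
    exact setCode_triple ht
  simp only [support, Finset.mem_insert, Finset.mem_singleton] at hx
  simp only [tripleCodes, List.mem_cons, List.not_mem_nil, or_false]
  have hmem : ∀ y ∈ t, y ≠ x ∧ (y = a ∨ y = b ∨ y = c ∨ y = d) := fun y hy =>
    ⟨fun h => hxt (h ▸ hy), by simpa [support] using htq hy⟩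
  rcases hx with rfl | rfl | rfl | rfl
  · refine .inr (.inr (.inr (key _ _ _ fun y hy => ?_)))
    have := hmem y hy
    simp only [Finset.mem_insert, Finset.mem_singleton]
    tauto
  · refine .inr (.inr (.inl (key _ _ _ fun y hy => ?_)))
    have := hmem y hy
    simp only [Finset.mem_insert, Finset.mem_singleton]
    tauto
  · refine .inr (.inl (key _ _ _ fun y hy => ?_))
    have := hmem y hy
    simp only [Finset.mem_insert, Finset.mem_singleton]
    tauto
  · refine .inl (key _ _ _ fun y hy => ?_)
    have := hmem y hy
    simp only [Finset.mem_insert, Finset.mem_singleton]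
    tauto

lemma length_quads : quads.length = 1583 := by decide +kernel

lemma all_quads_distinct : (quads.all fun (a, b, c, d) =>
    a ≠ b ∧ a ≠ c ∧ a ≠ d ∧ b ≠ c ∧ b ≠ d ∧ c ≠ d) = true := by decide +kernel

lemma card_support_of_mem_quads {q : Quad} (hq : q ∈ quads) : (support q).card = 4 := by
  have h := List.all_eq_true.mp all_quads_distinct q hq
  simp only [decide_eq_true_eq] at h
  obtain ⟨hab, hac, had, hbc, hbd, hcd⟩ := h
  exact Finset.card_eq_succ.mpr ⟨q.1, {q.2.1, q.2.2.1, q.2.2.2}, by simp [hab, hac, had], rfl,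
    Finset.card_eq_three.mpr ⟨_, _, _, hbc, hbd, hcd, rfl⟩⟩

lemma nodup_tripleCodes_quads : (quads.flatMap tripleCodes).Nodup :=
  (nodup_of_allFresh (m := 0) (by decide +kernel)).1

lemma eq_of_subset_support {q r : Quad} {t : Finset (Fin 35)} (hq : q ∈ quads) (hr : r ∈ quads)
    (ht : t.card = 3) (htq : t ⊆ support q) (htr : t ⊆ support r) : q = r := by
  by_contra hqr
  have hdisj : quads.Pairwise (Function.onFun List.Disjoint tripleCodes) :=
    (List.nodup_flatMap.mp nodup_tripleCodes_quads).2
  have : Std.Symm (Function.onFun List.Disjoint tripleCodes) := ⟨fun _ _ h => h.symm⟩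
  exact hdisj.forall hq hr hqr
    (setCode_mem_tripleCodes (card_support_of_mem_quads hq) ht htq)
    (setCode_mem_tripleCodes (card_support_of_mem_quads hr) ht htr)

lemma nodup_quads : quads.Nodup :=
  (List.nodup_flatMap.mp nodup_tripleCodes_quads).2.imp fun {q r} h hqr => by
    subst hqr
    exact h (a := code q.1 q.2.1 q.2.2.1) (by simp [tripleCodes]) (by simp [tripleCodes])

/-- The blocks of the design, as sets of points. -/
def blocks : Finset (Finset (Fin 35)) := (quads.map support).toFinset

lemma isPQS_blocks : IsPQS 35 blocks := by
  refine ⟨fun b hb => ?_, fun t ht => Finset.card_le_one.mpr fun b hb c hc => ?_⟩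
  · simp only [blocks, List.mem_toFinset, List.mem_map] at hb
    obtain ⟨q, hq, rfl⟩ := hb
    exact card_support_of_mem_quads hq
  · simp only [blocks, Finset.mem_filter, List.mem_toFinset, List.mem_map] at hb hc
    obtain ⟨⟨q, hq, rfl⟩, htq⟩ := hb
    obtain ⟨⟨r, hr, rfl⟩, htr⟩ := hc
    rw [eq_of_subset_support hq hr ht htq htr]

lemma card_blocks : blocks.card = 1583 := by
  rw [blocks, List.toFinset_card_of_nodup, List.length_map, length_quads]
  refine nodup_quads.map_on fun q hq r hr hqr => ?_
  obtain ⟨t, htq, ht⟩ := Finset.exists_subset_card_eq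
    (show 3 ≤ (support q).card by rw [card_support_of_mem_quads hq]; norm_num)
  exact eq_of_subset_support hq hr ht htq (hqr ▸ htq)

end PackingDesign35

/-- There exists a 3-(35,4,1) packing design with 1583 blocks; consequently
A(35,4,4) = J(35,4,4) = 1583. -/
theorem exists_MPQS_35 :
    (∃ B : Finset (Finset (Fin 35)), IsPQS 35 B ∧ B.card = 1583) ∧
    packingNumber 35 = johnsonBound 35 ∧ johnsonBound 35 = 1583 := by
  have hJ : johnsonBound 35 = 1583 := by norm_num [johnsonBound]
  have hex : ∃ B : Finset (Finset (Fin 35)), IsPQS 35 B ∧ B.card = 1583 :=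
    ⟨_, PackingDesign35.isPQS_blocks, PackingDesign35.card_blocks⟩
  have hmax : IsGreatest {N | ∃ B : Finset (Finset (Fin 35)), IsPQS 35 B ∧ B.card = N} 1583 := by
    refine ⟨hex, ?_⟩
    rintro N ⟨B, hB, rfl⟩
    simpa using hB.card_le_s3
  exact ⟨hex, hmax.csSup_eq.trans hJ.symm, hJ⟩
end

section
/- There exists a holey packing quadruple system HPQS(35,11) having exactly J(35,4,4) − J(11,4,4) = 1583 − 35 = 1548 blocks. -/
/-- There exists a holey packing quadruple system HPQS(n,m) with exactly `N`
blocks: a PQS(n) together with an m-element hole `Y` such that no 3-element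
subset of `Y` is contained in any block. -/
def ExistsHPQS (n m N : ℕ) : Prop :=
  ∃ (B : Finset (Finset (Fin n))) (Y : Finset (Fin n)),
    IsPQS n B ∧ Y.card = m ∧
    (∀ t : Finset (Fin n), t ⊆ Y → t.card = 3 → ∀ b ∈ B, ¬ t ⊆ b) ∧
    B.card = N

namespace HPQS

/-- The action of `(i, j) ∈ ℤ/6 × ℤ/4` on the points `0, …, 34`: regular on the 24 points outside
the hole, and on the hole `{24, …, 34}` through the second factor only. -/
def act (i j x : ℕ) : ℕ :=
  if x < 24 then (x / 4 + i) % 6 * 4 + (x + j) % 4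
  else if x < 32 then x / 4 * 4 + (x + j) % 4
  else if x < 34 then 32 + (x + j) % 2
  else x

/-- The images of the given blocks under the elements `(i, j)` with `i < m` and `j < k`. -/
def orbits (m k : ℕ) (base : List (List ℕ)) : List (List ℕ) :=
  base.flatMap fun l => (List.range m).flatMap fun i => (List.range k).map fun j => l.map (act i j)

/-- The blocks of the design, generated from 72 base blocks. For a base block with a nontrivial
stabilizer the orbit is traced out by a rectangle of coset representatives. -/
def blocks : List (List ℕ) :=
  orbits 6 4
    [[0, 1, 5, 31], [0, 1, 6, 23], [0, 1, 7, 13], [0, 1, 8, 29], [0, 1, 9, 32], [0, 1, 10, 11],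
    [0, 1, 12, 22], [0, 1, 16, 27], [0, 1, 17, 20], [0, 1, 21, 30], [0, 1, 24, 28],
    [0, 1, 25, 34], [0, 1, 26, 33], [0, 2, 4, 27], [0, 2, 5, 23], [0, 2, 8, 31], [0, 2, 9, 19],
    [0, 2, 13, 20], [0, 2, 16, 24], [0, 4, 8, 22], [0, 4, 9, 28], [0, 4, 10, 34], [0, 4, 11, 26],
    [0, 4, 13, 31], [0, 4, 14, 25], [0, 4, 15, 33], [0, 4, 19, 32], [0, 4, 23, 24], [0, 5, 8, 32],
    [0, 5, 13, 18], [0, 5, 26, 27], [0, 5, 29, 33], [0, 5, 30, 34], [0, 6, 8, 19], [0, 6, 9, 21],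
    [0, 6, 16, 26], [0, 6, 24, 31], [0, 6, 27, 30], [0, 6, 28, 33], [0, 6, 29, 32],
    [0, 7, 15, 24], [0, 7, 16, 28], [0, 7, 25, 30], [0, 7, 27, 32], [0, 7, 31, 34],
    [0, 8, 17, 34], [0, 8, 18, 30], [0, 9, 24, 29], [0, 9, 26, 30], [0, 10, 26, 32],
    [0, 10, 27, 33], [0, 11, 24, 27], [0, 11, 29, 31], [0, 11, 30, 32], [0, 13, 24, 30],
    [0, 13, 26, 28], [0, 13, 27, 34], [0, 14, 28, 31]] ++
  orbits 6 2
    [[0, 1, 14, 15], [0, 2, 32, 34], [0, 5, 14, 19], [0, 7, 14, 17], [0, 14, 32, 33]] ++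
  orbits 6 1
    [[0, 1, 2, 3]] ++
  orbits 3 4
    [[0, 4, 12, 16], [0, 5, 12, 17], [0, 12, 24, 26], [0, 12, 25, 27], [0, 12, 28, 29],
    [0, 12, 30, 31], [0, 12, 33, 34]] ++
  orbits 3 2
    [[0, 2, 12, 14]]

/-- A key for sets of points below 37: the first three power sums modulo 37. -/
def key (l : List ℕ) : ℕ :=
  l.sum % 37 + 37 * ((l.map (· ^ 2)).sum % 37) + 1369 * ((l.map (· ^ 3)).sum % 37)

lemma key_eq_of_perm {l₁ l₂ : List ℕ} (h : l₁.Perm l₂) : key l₁ = key l₂ := by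
  simp only [key, h.sum_eq, (h.map _).sum_eq]

/-- The keys of the sets obtained from `l` by deleting one element. -/
def eraseKeys (l : List ℕ) : List ℕ :=
  l.map fun x => key (l.erase x)

/-- Test whether the entries of a list are distinct and not among the set bits of `s`. -/
def distinctFrom : ℕ → List ℕ → Bool
  | _, [] => true
  | s, c :: l => !s.testBit c && distinctFrom (s ||| 1 <<< c) l

lemma nodup_of_distinctFrom (l : List ℕ) :
    ∀ s, distinctFrom s l = true → l.Nodup ∧ ∀ c ∈ l, s.testBit c = false := by
  induction l with
  | nil => simp
  | cons c l ih =>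
    intro s h
    simp only [distinctFrom, Bool.and_eq_true, Bool.not_eq_true'] at h
    obtain ⟨hnd, hs⟩ := ih _ h.2
    simp only [Nat.testBit_or, Bool.or_eq_false_iff] at hs
    refine ⟨List.nodup_cons.2 ⟨fun hc => ?_, hnd⟩, ?_⟩
    · simpa [Nat.testBit_shiftLeft] using (hs c hc).2
    · rintro d (_ | ⟨_, hd⟩)
      exacts [h.1, (hs d hd).1]

/-- Being a 4-element list of points with at most two of them in the hole. -/
def IsBlock (l : List ℕ) : Prop :=
  l.length = 4 ∧ l.Nodup ∧ (∀ x ∈ l, x < 35) ∧ (l.filter (24 ≤ ·)).length ≤ 2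

instance : DecidablePred IsBlock := fun _ => inferInstanceAs (Decidable (_ ∧ _))

lemma length_blocks : blocks.length = 1548 := by
  decide +kernel

lemma isBlock_of_mem_blocks : ∀ l ∈ blocks, IsBlock l := by
  decide +kernel

lemma nodup_flatMap_eraseKeys : (blocks.flatMap eraseKeys).Nodup :=
  (nodup_of_distinctFrom _ 0 (by decide +kernel)).1

/-- The finite set of points listed in `l`. -/
def toSet (l : List ℕ) : Finset (Fin 35) :=
  Finset.univ.filter fun x => x.val ∈ l

lemma map_toSet {l : List ℕ} (h : ∀ x ∈ l, x < 35) :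
    (toSet l).map Fin.valEmbedding = l.toFinset := by
  ext x
  simp only [toSet, Finset.mem_map, Finset.mem_filter, Finset.mem_univ, true_and,
    Fin.valEmbedding_apply, List.mem_toFinset]
  exact ⟨fun ⟨y, hy, hxy⟩ => hxy ▸ hy, fun hx => ⟨⟨x, h x hx⟩, hx, rfl⟩⟩

lemma card_toSet {l : List ℕ} (h : IsBlock l) : (toSet l).card = 4 := by
  rw [← Finset.card_map Fin.valEmbedding, map_toSet h.2.2.1, List.toFinset_card_of_nodup h.2.1, h.1]

/-- The key of a finite set of points. -/
noncomputable def setKey (t : Finset (Fin 35)) : ℕ :=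
  key (t.map Fin.valEmbedding).toList

lemma setKey_mem_eraseKeys {l : List ℕ} (h : IsBlock l) {t : Finset (Fin 35)} (ht : t.card = 3)
    (htl : t ⊆ toSet l) : setKey t ∈ eraseKeys l := by
  have hsub : t.map Fin.valEmbedding ⊆ l.toFinset :=
    map_toSet h.2.2.1 ▸ Finset.map_subset_map.2 htl
  have hlt : (t.map Fin.valEmbedding).card < l.toFinset.card := by
    rw [Finset.card_map, ht, List.toFinset_card_of_nodup h.2.1, h.1]
    norm_num
  obtain ⟨x, hx, hxt⟩ := Finset.exists_mem_notMem_of_card_lt_card hlt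
  rw [List.mem_toFinset] at hx
  have hsp : (t.map Fin.valEmbedding).toList.Subperm (l.erase x) := by
    refine List.subperm_of_subset (Finset.nodup_toList _) fun y hy => ?_
    rw [Finset.mem_toList] at hy
    rw [h.2.1.mem_erase_iff]
    exact ⟨fun hyx => hxt (hyx ▸ hy), List.mem_toFinset.1 (hsub hy)⟩
  refine List.mem_map.2 ⟨x, hx, (key_eq_of_perm (hsp.perm_of_length_le ?_)).symm⟩
  rw [List.length_erase_of_mem hx, h.1, Finset.length_toList, Finset.card_map, ht]

lemma pairwise_disjoint_eraseKeys :
    blocks.Pairwise (Function.onFun List.Disjoint eraseKeys) :=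
  (List.nodup_flatMap.1 nodup_flatMap_eraseKeys).2

lemma nodup_blocks : blocks.Nodup := by
  refine pairwise_disjoint_eraseKeys.imp_of_mem fun {a b} ha _ hab hne => ?_
  subst hne
  have h4 := (isBlock_of_mem_blocks a ha).1
  obtain ⟨x, hx⟩ := List.exists_mem_of_length_pos (l := a) (by omega)
  exact hab (List.mem_map_of_mem hx) (List.mem_map_of_mem hx)

lemma eq_of_subset_of_subset {l₁ l₂ : List ℕ} (h₁ : l₁ ∈ blocks) (h₂ : l₂ ∈ blocks)
    {t : Finset (Fin 35)} (ht : t.card = 3) (ht₁ : t ⊆ toSet l₁) (ht₂ : t ⊆ toSet l₂) :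
    l₁ = l₂ := by
  by_contra hne
  have hsymm : Std.Symm (Function.onFun List.Disjoint eraseKeys) := ⟨fun _ _ h => h.symm⟩
  exact pairwise_disjoint_eraseKeys.forall h₁ h₂ hne
    (setKey_mem_eraseKeys (isBlock_of_mem_blocks _ h₁) ht ht₁)
    (setKey_mem_eraseKeys (isBlock_of_mem_blocks _ h₂) ht ht₂)

lemma injOn_toSet : Set.InjOn toSet {l | l ∈ blocks} := by
  intro l₁ h₁ l₂ h₂ h
  obtain ⟨t, ht, ht3⟩ := Finset.exists_subset_card_eq
    (show 3 ≤ (toSet l₁).card by rw [card_toSet (isBlock_of_mem_blocks _ h₁)]; norm_num)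
  exact eq_of_subset_of_subset h₁ h₂ ht3 ht (h ▸ ht)

/-- The blocks of the design as finite sets. -/
def blockSet : Finset (Finset (Fin 35)) :=
  blocks.toFinset.image toSet

lemma mem_blockSet {b : Finset (Fin 35)} : b ∈ blockSet ↔ ∃ l ∈ blocks, toSet l = b := by
  simp [blockSet]

lemma card_blockSet : blockSet.card = 1548 := by
  rw [blockSet, Finset.card_image_of_injOn (by simpa using injOn_toSet),
    List.toFinset_card_of_nodup nodup_blocks, length_blocks]

lemma isPQS_blockSet : IsPQS 35 blockSet := by
  refine ⟨fun b hb => ?_, fun t ht => Finset.card_le_one.2 fun b₁ hb₁ b₂ hb₂ => ?_⟩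
  · obtain ⟨l, hl, rfl⟩ := mem_blockSet.1 hb
    exact card_toSet (isBlock_of_mem_blocks l hl)
  · rw [Finset.mem_filter, mem_blockSet] at hb₁ hb₂
    obtain ⟨⟨l₁, h₁, rfl⟩, ht₁⟩ := hb₁
    obtain ⟨⟨l₂, h₂, rfl⟩, ht₂⟩ := hb₂
    rw [eq_of_subset_of_subset h₁ h₂ ht ht₁ ht₂]

/-- The 11 points of the hole. -/
def hole : Finset (Fin 35) :=
  Finset.univ.filter fun x => 24 ≤ x.val

lemma not_subset_of_subset_hole {t b : Finset (Fin 35)} (htY : t ⊆ hole) (ht : t.card = 3)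
    (hb : b ∈ blockSet) : ¬ t ⊆ b := by
  intro htb
  obtain ⟨l, hl, rfl⟩ := mem_blockSet.1 hb
  have hsub : t.map Fin.valEmbedding ⊆ (l.filter (24 ≤ ·)).toFinset := by
    intro y hy
    obtain ⟨x, hx, rfl⟩ := Finset.mem_map.1 hy
    have h1 := htY hx
    have h2 := htb hx
    simp only [hole, toSet, Finset.mem_filter, Finset.mem_univ, true_and] at h1 h2
    simpa using ⟨h2, h1⟩
  have h3 := (Finset.card_le_card hsub).trans (List.toFinset_card_le _)
  rw [Finset.card_map, ht] at h3
  have h4 := (isBlock_of_mem_blocks l hl).2.2.2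
  omega

end HPQS

/-- There exists an HPQS(35,11) with exactly J(35,4,4) - J(11,4,4) = 1548
blocks. -/
theorem exists_HPQS_35_11 :
    ExistsHPQS 35 11 (johnsonBound 35 - johnsonBound 11) ∧
    johnsonBound 35 - johnsonBound 11 = 1548 := by
  have hJ : johnsonBound 35 - johnsonBound 11 = 1548 := by decide
  refine ⟨?_, hJ⟩
  rw [hJ]
  exact ⟨HPQS.blockSet, HPQS.hole, HPQS.isPQS_blockSet, by decide +kernel,
    fun t htY ht b hb => HPQS.not_subset_of_subset_hole htY ht hb, HPQS.card_blockSet⟩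
end
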